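/- arXiv:2005.12583 — 5 statements merged into one kernel-verified Lean document; each statement's English description precedes it below -/
import Mathlib

section
/- (Ingham's Tauberian theorem, Theorem 1.2 of the paper.) Let X be a complex Banach space and let g : [0,∞) → X be bounded and uniformly continuous. Suppose there exists a locally Bochner-integrable function F : ℝ → X such that for every continuous compactly supported function ψ : ℝ → ℝ one has lim_{ε→0⁺} ∫_ℝ ĝ(ε+iη) ψ(η) dη = ∫_ℝ F(η) ψ(η) dη (limits and integrals in X). Then lim_{t→∞} ‖g(t)‖_X = 0. -/
open MeasureTheory Filter
open scoped FourierTransform Topology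

/-- There is an integrable kernel of integral `1` that is the Fourier transform of a continuous
compactly supported function. -/
theorem exists_hasCompactSupport_integrable_fourier :
    ∃ χ : ℝ → ℂ, Continuous χ ∧ HasCompactSupport χ ∧ Integrable (𝓕 χ) ∧ ∫ v, 𝓕 χ v = 1 := by
  let b : ContDiffBump (0 : ℝ) := default
  have hb : ContDiff ℝ ((⊤ : ℕ∞) : WithTop ℕ∞) (fun x : ℝ => (b x : ℂ)) :=
    Complex.ofRealCLM.contDiff.comp b.contDiff
  have hc : HasCompactSupport (fun x : ℝ => (b x : ℂ)) :=
    b.hasCompactSupport.comp_left (g := Complex.ofReal) Complex.ofReal_zero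
  let S := hc.toSchwartzMap hb
  have h_int : Integrable (𝓕 (fun x : ℝ => (b x : ℂ))) := (𝓕 S).integrable
  refine ⟨_, hb.continuous, hc, h_int, ?_⟩
  have h := congrFun (hb.continuous.fourierInv_fourier_eq S.integrable h_int) 0
  rw [Real.fourierInv_eq] at h
  simpa [b.one_of_mem_closedBall (Metric.mem_closedBall_self b.rIn_pos.le)] using h

/-- Fourier transform of a dilated and modulated function. -/
theorem fourier_fourierChar_smul_comp_div (χ : ℝ → ℂ) {R : ℝ} (hR : 0 < R) (s t : ℝ) :
    𝓕 (fun w => Real.fourierChar (w * s) • χ (w / R)) t = R • 𝓕 χ (R * (t - s)) := by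
  rw [Real.fourier_real_eq, Real.fourier_real_eq]
  have h := Measure.integral_comp_mul_left
    (fun v => Real.fourierChar (-(v * (R * (t - s)))) • χ v) R⁻¹
  rw [inv_inv, abs_of_pos hR] at h
  rw [← h]
  congr 1 with w
  rw [smul_smul, ← AddChar.map_add_eq_mul, div_eq_inv_mul]
  congr 2
  field_simp
  ring_nf

theorem norm_indicator_Ioi_le {X : Type*} [NormedAddCommGroup X] {g : ℝ → X} {M : ℝ}
    (hM : ∀ t, 0 ≤ t → ‖g t‖ ≤ M) (t : ℝ) :
    ‖(Set.Ioi (0 : ℝ)).indicator g t‖ ≤ M := by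
  by_cases ht : t ∈ Set.Ioi (0 : ℝ)
  · simpa [Set.indicator_of_mem ht] using hM t (le_of_lt ht)
  · simpa [Set.indicator_of_notMem ht] using (norm_nonneg _).trans (hM 0 le_rfl)

theorem aestronglyMeasurable_comp_add_inv_mul {X : Type*} [NormedAddCommGroup X] {f : ℝ → X}
    (hf : AEStronglyMeasurable f) {R : ℝ} (hR : R ≠ 0) (s : ℝ) :
    AEStronglyMeasurable fun v => f (s + R⁻¹ * v) :=
  hf.comp_quasiMeasurePreserving
    ((measurePreserving_add_left volume s).quasiMeasurePreserving.comp
      (Measure.quasiMeasurePreserving_smul volume (inv_ne_zero hR)))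

section

variable {X : Type*} [NormedAddCommGroup X] [NormedSpace ℂ X]

/-- Convergence against real test functions implies convergence against complex ones. -/
theorem tendsto_integral_smul_of_forall_real {ι : Type*} {l : Filter ι} {H : ι → ℝ → X} {F : ℝ → X}
    (hH : ∀ᶠ i in l, LocallyIntegrable (H i)) (hF : LocallyIntegrable F)
    (hlim : ∀ ψ : ℝ → ℝ, Continuous ψ → HasCompactSupport ψ →
      Tendsto (fun i => ∫ η, (ψ η : ℂ) • H i η) l (𝓝 (∫ η, (ψ η : ℂ) • F η)))
    {φ : ℝ → ℂ} (hφ : Continuous φ) (hφc : HasCompactSupport φ) :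
    Tendsto (fun i => ∫ η, φ η • H i η) l (𝓝 (∫ η, φ η • F η)) := by
  have hre : HasCompactSupport fun η => (φ η).re := hφc.comp_left (g := Complex.re) rfl
  have him : HasCompactSupport fun η => (φ η).im := hφc.comp_left (g := Complex.im) rfl
  have h_int : ∀ {ψ : ℝ → ℝ}, Continuous ψ → HasCompactSupport ψ → ∀ {f : ℝ → X},
      LocallyIntegrable f → Integrable fun η => (ψ η : ℂ) • f η := fun hψ hψc f hf =>
    hf.integrable_smul_left_of_hasCompactSupport (Complex.continuous_ofReal.comp hψ)
      (hψc.comp_left (g := Complex.ofReal) Complex.ofReal_zero)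
  have key : ∀ f : ℝ → X, LocallyIntegrable f → ∫ η, φ η • f η =
      (∫ η, ((φ η).re : ℂ) • f η) + Complex.I • ∫ η, ((φ η).im : ℂ) • f η := fun f hf => by
    have hadd := integral_add (h_int (Complex.continuous_re.comp hφ) hre hf)
      ((h_int (Complex.continuous_im.comp hφ) him hf).smul Complex.I)
    simp only [Pi.smul_apply, Function.comp_apply, integral_smul] at hadd
    rw [← hadd]
    congr 1 with η
    rw [smul_smul, ← add_smul, mul_comm, Complex.re_add_im]
  rw [key F hF]
  refine ((hlim _ (Complex.continuous_re.comp hφ) hre).add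
    ((hlim _ (Complex.continuous_im.comp hφ) him).const_smul Complex.I)).congr' ?_
  filter_upwards [hH] with i hi using (key _ hi).symm

/-- The Laplace transform on a vertical line is the Fourier transform of a damped function. -/
theorem integral_Ioi_cexp_smul_eq_fourier (g : ℝ → X) (ε w : ℝ) :
    ∫ t in Set.Ioi (0 : ℝ),
        Complex.exp (-((ε : ℂ) + ((2 * Real.pi * w : ℝ) : ℂ) * Complex.I) * (t : ℂ)) • g t =
      𝓕 (fun t => (Real.exp (-ε * t) : ℂ) • (Set.Ioi (0 : ℝ)).indicator g t) w := by
  rw [Real.fourier_real_eq_integral_exp_smul, ← integral_indicator measurableSet_Ioi]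
  congr 1 with t
  by_cases ht : t ∈ Set.Ioi (0 : ℝ)
  · simp only [Set.indicator_of_mem ht, smul_smul]
    rw [Complex.ofReal_exp, ← Complex.exp_add]
    congr 2
    push_cast
    ring
  · simp [Set.indicator_of_notMem ht]

theorem integrable_exp_smul_indicator {g : ℝ → X} {M : ℝ} (hM : ∀ t, 0 ≤ t → ‖g t‖ ≤ M)
    (hg : AEStronglyMeasurable ((Set.Ioi (0 : ℝ)).indicator g)) {ε : ℝ} (hε : 0 < ε) :
    Integrable fun t => (Real.exp (-ε * t) : ℂ) • (Set.Ioi (0 : ℝ)).indicator g t := by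
  have h := (integrable_indicator_iff measurableSet_Ioi).2 (exp_neg_integrableOn_Ioi 0 hε)
  refine (h.mul_const M).mono' ?_ (ae_of_all _ fun t => ?_)
  · have hc : Continuous fun t : ℝ => (Real.exp (-ε * t) : ℂ) := by fun_prop
    exact hc.aestronglyMeasurable.smul hg
  · by_cases ht : t ∈ Set.Ioi (0 : ℝ)
    · simp only [Set.indicator_of_mem ht, norm_smul, Complex.norm_real, Real.norm_eq_abs,
        Real.abs_exp]
      gcongr
      exact hM t (le_of_lt ht)
    · simp [Set.indicator_of_notMem ht]

/-- If the Laplace transform of `g` has boundary distribution `F`, then `g` pairs with the Fourier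
transform of a test function as `F` pairs with the test function. -/
theorem integral_fourier_smul_indicator_eq [CompleteSpace X] {g F : ℝ → X} {M : ℝ}
    (hM : ∀ t, 0 ≤ t → ‖g t‖ ≤ M) (hg : AEStronglyMeasurable ((Set.Ioi (0 : ℝ)).indicator g))
    (hF : LocallyIntegrable F)
    (hlim : ∀ ψ : ℝ → ℝ, Continuous ψ → HasCompactSupport ψ →
      Tendsto
        (fun ε : ℝ => ∫ η : ℝ, (ψ η : ℂ) •
          (∫ t in Set.Ioi (0 : ℝ),
            Complex.exp (-((ε : ℂ) + (η : ℂ) * Complex.I) * (t : ℂ)) • g t))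
        (𝓝[>] 0) (𝓝 (∫ η : ℝ, (ψ η : ℂ) • F η)))
    {φ : ℝ → ℂ} (hφ : Continuous φ) (hφc : HasCompactSupport φ) (hφi : Integrable (𝓕 φ)) :
    ∫ t, 𝓕 φ t • (Set.Ioi (0 : ℝ)).indicator g t = ∫ w, φ w • F (2 * Real.pi * w) := by
  have hpi : (2 * Real.pi) ≠ 0 := by positivity
  have hH : ∀ᶠ ε : ℝ in 𝓝[>] 0, LocallyIntegrable fun η : ℝ => ∫ t in Set.Ioi (0 : ℝ),
      Complex.exp (-((ε : ℂ) + (η : ℂ) * Complex.I) * (t : ℂ)) • g t := by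
    filter_upwards [self_mem_nhdsWithin] with ε hε
    have hc : Continuous (𝓕 (fun t => (Real.exp (-ε * t) : ℂ) • (Set.Ioi (0 : ℝ)).indicator g t)) :=
      VectorFourier.fourierIntegral_continuous Real.continuous_fourierChar
        (by fun_prop) (integrable_exp_smul_indicator hM hg hε)
    refine Continuous.locallyIntegrable ?_
    convert hc.comp (by fun_prop : Continuous fun η : ℝ => (2 * Real.pi)⁻¹ * η)
      using 1
    ext η
    simp only [Function.comp, ← integral_Ioi_cexp_smul_eq_fourier, mul_inv_cancel_left₀ hpi]
  have hs : ∀ f : ℝ → X, ∫ w, φ w • f (2 * Real.pi * w) =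
      |(2 * Real.pi)⁻¹| • ∫ η, φ ((2 * Real.pi)⁻¹ * η) • f η := fun f => by
    rw [← Measure.integral_comp_mul_left]
    simp only [inv_mul_cancel_left₀ hpi]
  have hcomp := (tendsto_integral_smul_of_forall_real hH hF hlim
    (φ := fun η => φ ((2 * Real.pi)⁻¹ * η)) (by fun_prop)
    (hφc.comp_homeomorph (Homeomorph.mulLeft₀ _ (inv_ne_zero hpi)))).const_smul |(2 * Real.pi)⁻¹|
  rw [← hs] at hcomp
  refine tendsto_nhds_unique (f := fun ε : ℝ => ∫ t, 𝓕 φ t •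
    ((Real.exp (-ε * t) : ℂ) • (Set.Ioi (0 : ℝ)).indicator g t)) (l := 𝓝[>] 0) ?_
    (hcomp.congr' ?_)
  · refine tendsto_integral_filter_of_dominated_convergence (fun t => ‖𝓕 φ t‖ * M) ?_ ?_
      (hφi.norm.mul_const M) (ae_of_all _ fun t => ?_)
    · filter_upwards [self_mem_nhdsWithin] with ε hε
      exact hφi.1.smul (integrable_exp_smul_indicator hM hg hε).1
    · filter_upwards [self_mem_nhdsWithin] with ε hε
      refine ae_of_all _ fun t => ?_
      rw [norm_smul]
      gcongr
      by_cases ht : t ∈ Set.Ioi (0 : ℝ)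
      · rw [norm_smul, Complex.norm_real, Real.norm_eq_abs, Real.abs_exp]
        have h1 : Real.exp (-ε * t) ≤ 1 :=
          Real.exp_le_one_iff.2 (by have := mul_pos (Set.mem_Ioi.1 hε) (Set.mem_Ioi.1 ht); linarith)
        exact (mul_le_of_le_one_left (norm_nonneg _) h1).trans (norm_indicator_Ioi_le hM t)
      · simpa [Set.indicator_of_notMem ht] using (norm_nonneg _).trans (hM 0 le_rfl)
    · have hc : Continuous fun ε : ℝ => 𝓕 φ t •
          ((Real.exp (-ε * t) : ℂ) • (Set.Ioi (0 : ℝ)).indicator g t) := by fun_prop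
      simpa using (hc.tendsto 0).mono_left nhdsWithin_le_nhds
  · filter_upwards [self_mem_nhdsWithin] with ε hε
    rw [← hs fun η : ℝ => ∫ t in Set.Ioi (0 : ℝ),
      Complex.exp (-((ε : ℂ) + (η : ℂ) * Complex.I) * (t : ℂ)) • g t]
    simp only [integral_Ioi_cexp_smul_eq_fourier]
    have hflip := (VectorFourier.integral_fourierIntegral_smul_eq_flip (L := innerₗ ℝ)
      (μ := volume) (ν := volume)
      Real.continuous_fourierChar (by fun_prop) (hφ.integrable_of_hasCompactSupport hφc)
      (integrable_exp_smul_indicator hM hg hε)).symm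
    rwa [flip_innerₗ] at hflip

/-- Averages of `g` at scale `R⁻¹` approximate `g`, far out and for large `R`. -/
theorem tendsto_integral_smul_indicator_sub {g : ℝ → X} {M : ℝ}
    (hM : ∀ t, 0 ≤ t → ‖g t‖ ≤ M) (hg : AEStronglyMeasurable ((Set.Ioi (0 : ℝ)).indicator g))
    (hg_uc : UniformContinuousOn g (Set.Ici 0)) {K : ℝ → ℂ} (hK : Integrable K) :
    Tendsto (fun p : ℝ × ℝ => ∫ v, K v •
      ((Set.Ioi (0 : ℝ)).indicator g (p.2 + p.1⁻¹ * v) - g p.2)) (atTop ×ˢ atTop) (𝓝 0) := by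
  have hfst : Tendsto (fun p : ℝ × ℝ => p.1) (atTop ×ˢ atTop) atTop := tendsto_fst
  have hsnd : Tendsto (fun p : ℝ × ℝ => p.2) (atTop ×ˢ atTop) atTop := tendsto_snd
  have h0 : ∫ v, K v • (0 : X) = 0 := by simp
  rw [← h0]
  refine tendsto_integral_filter_of_dominated_convergence (fun v => ‖K v‖ * (M + M)) ?_ ?_
    (hK.norm.mul_const _) (ae_of_all _ fun v => ?_)
  · filter_upwards [hfst.eventually_gt_atTop 0] with p hp
    refine hK.1.smul (AEStronglyMeasurable.sub ?_ aestronglyMeasurable_const)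
    exact aestronglyMeasurable_comp_add_inv_mul hg hp.ne' p.2
  · filter_upwards [hsnd.eventually_ge_atTop 0] with p hp
    refine ae_of_all _ fun v => ?_
    rw [norm_smul]
    gcongr
    exact (norm_sub_le _ _).trans (add_le_add (norm_indicator_Ioi_le hM _) (hM _ hp))
  · refine Tendsto.const_smul ?_ _
    rw [Metric.uniformContinuousOn_iff] at hg_uc
    rw [Metric.tendsto_nhds]
    intro δ hδ
    obtain ⟨r, hr, h⟩ := hg_uc δ hδ
    have hv : Tendsto (fun p : ℝ × ℝ => p.1⁻¹ * v) (atTop ×ˢ atTop) (𝓝 0) := by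
      simpa using (tendsto_inv_atTop_zero.comp hfst).mul_const v
    filter_upwards [Metric.tendsto_nhds.1 hv (min r 1) (by positivity),
      hsnd.eventually_ge_atTop 1] with p hp1 hp2
    rw [Real.dist_eq, sub_zero, lt_min_iff] at hp1
    have hpos : 0 < p.2 + p.1⁻¹ * v := by linarith [(abs_lt.1 hp1.2).1]
    rw [Set.indicator_of_mem (show _ ∈ Set.Ioi (0 : ℝ) from hpos), dist_zero_right, ← dist_eq_norm]
    refine h _ hpos.le _ (Set.mem_Ici.2 (by linarith)) ?_
    simpa [Real.dist_eq] using hp1.1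

end


/-- **Ingham's Tauberian theorem** (Theorem 1.2 of the paper).
Let `X` be a complex Banach space and `g : [0,∞) → X` bounded and uniformly continuous.
If there is a locally Bochner-integrable `F : ℝ → X` such that for every continuous
compactly supported `ψ : ℝ → ℝ` one has
`lim_{ε→0⁺} ∫ ĝ(ε+iη) ψ(η) dη = ∫ F(η) ψ(η) dη`
(where `ĝ(λ) = ∫₀^∞ e^{-λt} g(t) dt`), then `‖g(t)‖ → 0` as `t → ∞`. -/
theorem ingham_tauberian
    {X : Type*} [NormedAddCommGroup X] [NormedSpace ℂ X] [CompleteSpace X]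
    (g : ℝ → X)
    (hg_bdd : ∃ M : ℝ, ∀ t : ℝ, 0 ≤ t → ‖g t‖ ≤ M)
    (hg_uc : UniformContinuousOn g (Set.Ici 0))
    (F : ℝ → X)
    (hF : LocallyIntegrable F MeasureTheory.volume)
    (hlim : ∀ ψ : ℝ → ℝ, Continuous ψ → HasCompactSupport ψ →
      Tendsto
        (fun ε : ℝ => ∫ η : ℝ, (ψ η : ℂ) •
          (∫ t in Set.Ioi (0 : ℝ),
            Complex.exp (-((ε : ℂ) + (η : ℂ) * Complex.I) * (t : ℂ)) • g t))
        (nhdsWithin 0 (Set.Ioi 0))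
        (nhds (∫ η : ℝ, (ψ η : ℂ) • F η))) :
    Tendsto (fun t : ℝ => ‖g t‖) atTop (nhds 0) := by
  obtain ⟨M, hM⟩ := hg_bdd
  obtain ⟨χ, hχ, hχc, hχi, hχ1⟩ := exists_hasCompactSupport_integrable_fourier
  have hg : AEStronglyMeasurable ((Set.Ioi (0 : ℝ)).indicator g) :=
    (aestronglyMeasurable_indicator_iff measurableSet_Ioi).2
      ((hg_uc.continuousOn.mono Set.Ioi_subset_Ici_self).aestronglyMeasurable measurableSet_Ioi)
  -- For fixed `R`, the average of `g` near `s` decays by the Riemann-Lebesgue lemma.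
  have hzero : ∀ R : ℝ, 0 < R → Tendsto (fun s => ∫ v, 𝓕 χ v •
      (Set.Ioi (0 : ℝ)).indicator g (s + R⁻¹ * v)) atTop (𝓝 0) := by
    intro R hR
    have hRL := (Real.tendsto_integral_exp_smul_cocompact
      (fun w => χ (w / R) • F (2 * Real.pi * w))).comp
      (tendsto_neg_atTop_atBot.mono_right atBot_le_cocompact)
    refine hRL.congr fun s => ?_
    have hfou := funext fun t => fourier_fourierChar_smul_comp_div χ hR s t
    have hcont : Continuous fun w : ℝ => Real.fourierChar (w * s) • χ (w / R) :=
      (Real.continuous_fourierChar.comp (by fun_prop)).smul (by fun_prop)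
    have hsupp : HasCompactSupport fun w : ℝ => Real.fourierChar (w * s) • χ (w / R) := by
      refine HasCompactSupport.smul_left (f := fun w : ℝ => Real.fourierChar (w * s)) ?_
      simpa [div_eq_mul_inv, Function.comp_def] using
        hχc.comp_homeomorph (Homeomorph.mulRight₀ R⁻¹ (inv_ne_zero hR.ne'))
    have h_int : Integrable (𝓕 fun w : ℝ => Real.fourierChar (w * s) • χ (w / R)) := by
      rw [hfou]
      exact ((hχi.comp_mul_left' hR.ne').comp_sub_right s).smul R
    have hid := integral_fourier_smul_indicator_eq hM hg hF hlim hcont hsupp h_int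
    have hscale : ∫ v, 𝓕 χ v • (Set.Ioi (0 : ℝ)).indicator g (s + R⁻¹ * v) =
        ∫ t, (R • 𝓕 χ (R * (t - s))) • (Set.Ioi (0 : ℝ)).indicator g t := by
      rw [← integral_add_left_eq_self (fun t => (R • 𝓕 χ (R * (t - s))) • _) s]
      have h := Measure.integral_comp_mul_left
        (fun v => 𝓕 χ v • (Set.Ioi (0 : ℝ)).indicator g (s + R⁻¹ * v)) R
      simp only [inv_mul_cancel_left₀ hR.ne'] at h
      simp only [add_sub_cancel_left, smul_assoc]
      rw [integral_smul, h, abs_of_pos (inv_pos.2 hR), smul_inv_smul₀ hR.ne']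
    simp only [hfou] at hid
    rw [hscale, hid]
    simp [smul_assoc, Function.comp]
  have happrox := tendsto_integral_smul_indicator_sub hM hg hg_uc hχi
  rw [Metric.tendsto_nhds]
  intro δ hδ
  obtain ⟨R, hR, hR0⟩ := (((Metric.tendsto_nhds.1 happrox (δ / 2) (half_pos hδ)).curry).and
    (eventually_gt_atTop 0)).exists
  filter_upwards [hR, Metric.tendsto_nhds.1 (hzero R hR0) (δ / 2) (half_pos hδ)] with s h1 h2
  have hsub : ∫ v, 𝓕 χ v • ((Set.Ioi (0 : ℝ)).indicator g (s + R⁻¹ * v) - g s) =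
      (∫ v, 𝓕 χ v • (Set.Ioi (0 : ℝ)).indicator g (s + R⁻¹ * v)) - g s := by
    have h_int : Integrable fun v => 𝓕 χ v • (Set.Ioi (0 : ℝ)).indicator g (s + R⁻¹ * v) :=
      hχi.smul_bdd M (aestronglyMeasurable_comp_add_inv_mul hg hR0.ne' s)
        (ae_of_all _ fun v => norm_indicator_Ioi_le hM _)
    simp only [smul_sub]
    rw [integral_sub h_int (hχi.smul_const _), integral_smul_const, hχ1, one_smul]
  rw [hsub] at h1
  rw [dist_zero_right] at h1 h2 ⊢
  rw [norm_norm]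
  have := norm_sub_norm_le (g s) (∫ v, 𝓕 χ v • (Set.Ioi (0 : ℝ)).indicator g (s + R⁻¹ * v))
  rw [norm_sub_rev] at this
  linarith
end

section
/- (Key integration identity in the proof of Proposition 2.4.) Let Ω ⊆ ℝ^d be a bounded open set, v ∈ ℝ^d with v ≠ 0, k ∈ ℕ, and f : ℝ^d → [0,∞] measurable. Then ∫_Ω (∫₀^{t₋(x,v)} s^k · f(x − s·v) ds) dx = (1/(k+1)) · ∫_Ω t₊(y,v)^{k+1} · f(y) dy, where all integrals are Lebesgue integrals. -/
open MeasureTheory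

/-- Forward exit time: `t₊(x,v) = inf {s > 0 : x + s·v ∉ Ω}`. -/
noncomputable def tPlus {d : ℕ} (Ω : Set (EuclideanSpace ℝ (Fin d)))
    (x v : EuclideanSpace ℝ (Fin d)) : ℝ :=
  sInf {s : ℝ | 0 < s ∧ x + s • v ∉ Ω}

/-- Backward exit time: `t₋(x,v) = inf {s > 0 : x − s·v ∉ Ω}`. -/
noncomputable def tMinus {d : ℕ} (Ω : Set (EuclideanSpace ℝ (Fin d)))
    (x v : EuclideanSpace ℝ (Fin d)) : ℝ :=
  sInf {s : ℝ | 0 < s ∧ x - s • v ∉ Ω}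

/-- The pairs `(x, s)` with `0 < s` for which the segment from `x` to `x + s • v` lies in `Ω`. -/
def segmentSet {d : ℕ} (Ω : Set (EuclideanSpace ℝ (Fin d))) (v : EuclideanSpace ℝ (Fin d)) :
    Set (EuclideanSpace ℝ (Fin d) × ℝ) :=
  {p | 0 < p.2 ∧ ∀ r ∈ Set.Icc (0 : ℝ) 1, p.1 + (r * p.2) • v ∈ Ω}

section

variable {d : ℕ} {Ω : Set (EuclideanSpace ℝ (Fin d))} {v : EuclideanSpace ℝ (Fin d)}

theorem isOpen_segmentSet (hΩo : IsOpen Ω) : IsOpen (segmentSet Ω v) := by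
  refine (isOpen_lt continuous_const continuous_snd).inter ?_
  refine isOpen_iff_eventually.2 fun p hp => ?_
  refine isCompact_Icc.eventually_forall_of_forall_eventually fun r hr => ?_
  have hc : Continuous fun z : (EuclideanSpace ℝ (Fin d) × ℝ) × ℝ =>
      z.1.1 + (z.2 * z.1.2) • v := by fun_prop
  exact (hΩo.preimage hc).mem_nhds (hp r hr)

theorem tMinus_eq_tPlus_neg (x : EuclideanSpace ℝ (Fin d)) :
    tMinus Ω x v = tPlus Ω x (-v) := by
  simp [tMinus, tPlus, sub_eq_add_neg]

theorem tPlus_nonneg (x : EuclideanSpace ℝ (Fin d)) : 0 ≤ tPlus Ω x v :=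
  Real.sInf_nonneg fun _ hs => hs.1.le

/-- A bounded set is left in finite time along any nonzero direction. -/
theorem exists_exit_time (hΩb : Bornology.IsBounded Ω) (hv : v ≠ 0)
    (x : EuclideanSpace ℝ (Fin d)) : ∃ s : ℝ, 0 < s ∧ x + s • v ∉ Ω := by
  obtain ⟨R, hR⟩ := hΩb.subset_closedBall x
  have hv' : 0 < ‖v‖ := norm_pos_iff.2 hv
  refine ⟨(|R| + 1) / ‖v‖, by positivity, fun h => ?_⟩
  have h1 := hR h
  rw [mem_closedBall_iff_norm, add_sub_cancel_left, norm_smul, Real.norm_eq_abs,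
    abs_of_nonneg (by positivity), div_mul_cancel₀ _ hv'.ne'] at h1
  linarith [le_abs_self R]

theorem mem_segmentSet_iff (hΩo : IsOpen Ω) (hΩb : Bornology.IsBounded Ω) (hv : v ≠ 0)
    (x : EuclideanSpace ℝ (Fin d)) (s : ℝ) :
    (x, s) ∈ segmentSet Ω v ↔ x ∈ Ω ∧ s ∈ Set.Ioo 0 (tPlus Ω x v) := by
  have hbdd : BddBelow {s : ℝ | 0 < s ∧ x + s • v ∉ Ω} := ⟨0, fun _ hs => hs.1.le⟩
  constructor
  · rintro ⟨hs, h⟩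
    refine ⟨by simpa using h 0 (by simp), hs, ?_⟩
    have hs' : 0 < s := hs
    have hc : Continuous fun t : ℝ => x + t • v := by fun_prop
    have hend : x + s • v ∈ Ω := by simpa using h 1 (by simp)
    obtain ⟨ε, hε, hball⟩ := Metric.isOpen_iff.1 (hΩo.preimage hc) s hend
    refine (lt_add_of_pos_right s hε).trans_le
      (le_csInf (exists_exit_time hΩb hv x) fun t ht => ?_)
    by_contra! hlt
    refine ht.2 ?_
    rcases le_or_gt t s with hts | hts
    · have := h (t / s) ⟨by have := ht.1; positivity, (div_le_one hs').2 hts⟩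
      simpa [div_mul_cancel₀ _ hs'.ne'] using this
    · exact hball (by rw [Metric.mem_ball, Real.dist_eq, abs_lt]; constructor <;> linarith)
  · rintro ⟨hx, hs, hst⟩
    refine ⟨hs, fun r hr => ?_⟩
    rcases hr.1.eq_or_lt with rfl | hr0
    · simpa using hx
    by_contra hout
    have h1 : tPlus Ω x v ≤ r * s := csInf_le hbdd ⟨mul_pos hr0 hs, hout⟩
    nlinarith [hr.2]

theorem add_smul_mem_segmentSet_neg_iff (y : EuclideanSpace ℝ (Fin d)) (s : ℝ) :
    (y + s • v, s) ∈ segmentSet Ω (-v) ↔ (y, s) ∈ segmentSet Ω v := by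
  have key : ∀ r : ℝ, y + s • v + (r * s) • -v = y + ((1 - r) * s) • v := fun r => by module
  simp only [segmentSet, Set.mem_ofPred_eq, key]
  refine and_congr_right fun _ => ⟨fun h r hr => ?_, fun h r hr => ?_⟩
  · simpa using h (1 - r) ⟨by linarith [hr.2], by linarith [hr.1]⟩
  · exact h (1 - r) ⟨by linarith [hr.2], by linarith [hr.1]⟩

theorem setLIntegral_tPlus_eq (hΩo : IsOpen Ω) (hΩb : Bornology.IsBounded Ω) (hv : v ≠ 0)
    (G : EuclideanSpace ℝ (Fin d) × ℝ → ENNReal) :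
    ∫⁻ x in Ω, ∫⁻ s in Set.Ioo (0 : ℝ) (tPlus Ω x v), G (x, s) =
      ∫⁻ x, ∫⁻ s, (segmentSet Ω v).indicator G (x, s) := by
  classical
  rw [← lintegral_indicator hΩo.measurableSet]
  refine lintegral_congr fun x => ?_
  by_cases hx : x ∈ Ω
  · rw [Set.indicator_of_mem hx, ← lintegral_indicator measurableSet_Ioo]
    refine lintegral_congr fun s => ?_
    simp only [Set.indicator_apply, mem_segmentSet_iff hΩo hΩb hv, hx, true_and]
  · simp [mem_segmentSet_iff hΩo hΩb hv, hx]

end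

theorem setLIntegral_Ioo_pow {t : ℝ} (ht : 0 ≤ t) (k : ℕ) :
    ∫⁻ s in Set.Ioo (0 : ℝ) t, ENNReal.ofReal (s ^ k) =
      ENNReal.ofReal (1 / (k + 1 : ℝ)) * ENNReal.ofReal (t ^ (k + 1)) := by
  rw [← ofReal_integral_eq_lintegral_ofReal, ← integral_Ioc_eq_integral_Ioo,
    ← intervalIntegral.integral_of_le ht, integral_pow, ← ENNReal.ofReal_mul (by positivity)]
  · congr 1
    simp
    ring
  · exact ((continuous_pow k).integrableOn_Icc (a := 0) (b := t)).mono_set Set.Ioo_subset_Icc_self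
  · filter_upwards [ae_restrict_mem measurableSet_Ioo] with s hs
    exact pow_nonneg hs.1.le k

/-- Key integration identity in the proof of Proposition 2.4:
`∫_Ω ∫₀^{t₋(x,v)} s^k f(x − s·v) ds dx = (1/(k+1)) ∫_Ω t₊(y,v)^{k+1} f(y) dy`
for every `ℕ∞`-valued measurable `f`, bounded open `Ω`, and `v ≠ 0`. -/
theorem key_integration_identity {d : ℕ}
    (Ω : Set (EuclideanSpace ℝ (Fin d))) (hΩo : IsOpen Ω) (hΩb : Bornology.IsBounded Ω)
    (v : EuclideanSpace ℝ (Fin d)) (hv : v ≠ 0) (k : ℕ)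
    (f : EuclideanSpace ℝ (Fin d) → ENNReal) (hf : Measurable f) :
    ∫⁻ x in Ω, (∫⁻ s in Set.Ioo (0 : ℝ) (tMinus Ω x v),
        ENNReal.ofReal (s ^ k) * f (x - s • v)) =
      ENNReal.ofReal (1 / (k + 1 : ℝ)) *
        ∫⁻ y in Ω, ENNReal.ofReal (tPlus Ω y v ^ (k + 1)) * f y := by
  classical
  have hmeas : ∀ w, MeasurableSet (segmentSet Ω w) := fun _ =>
    (isOpen_segmentSet hΩo).measurableSet
  have hleft : Measurable fun p : EuclideanSpace ℝ (Fin d) × ℝ =>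
      ENNReal.ofReal (p.2 ^ k) * f (p.1 - p.2 • v) := by fun_prop
  have hright : Measurable fun p : EuclideanSpace ℝ (Fin d) × ℝ =>
      ENNReal.ofReal (p.2 ^ k) * f p.1 := by fun_prop
  simp only [tMinus_eq_tPlus_neg]
  calc _ = ∫⁻ x, ∫⁻ s, (segmentSet Ω (-v)).indicator
          (fun p => ENNReal.ofReal (p.2 ^ k) * f (p.1 - p.2 • v)) (x, s) :=
        setLIntegral_tPlus_eq hΩo hΩb (neg_ne_zero.2 hv)
          fun p => ENNReal.ofReal (p.2 ^ k) * f (p.1 - p.2 • v)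
    _ = ∫⁻ s, ∫⁻ x, (segmentSet Ω (-v)).indicator
          (fun p => ENNReal.ofReal (p.2 ^ k) * f (p.1 - p.2 • v)) (x, s) :=
        lintegral_lintegral_swap (hleft.indicator (hmeas _)).aemeasurable
    _ = ∫⁻ s, ∫⁻ y, (segmentSet Ω v).indicator
          (fun p => ENNReal.ofReal (p.2 ^ k) * f p.1) (y, s) := by
        refine lintegral_congr fun s => ?_
        rw [← lintegral_add_right_eq_self _ (s • v)]
        refine lintegral_congr fun y => ?_
        simp only [Set.indicator_apply, add_smul_mem_segmentSet_neg_iff, add_sub_cancel_right]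
    _ = ∫⁻ y, ∫⁻ s, (segmentSet Ω v).indicator
          (fun p => ENNReal.ofReal (p.2 ^ k) * f p.1) (y, s) :=
        lintegral_lintegral_swap
          ((hright.indicator (hmeas v)).comp measurable_swap).aemeasurable
    _ = ∫⁻ y in Ω, ∫⁻ s in Set.Ioo (0 : ℝ) (tPlus Ω y v), ENNReal.ofReal (s ^ k) * f y :=
        (setLIntegral_tPlus_eq hΩo hΩb hv fun p => ENNReal.ofReal (p.2 ^ k) * f p.1).symm
    _ = _ := by
        rw [← lintegral_const_mul' _ _ ENNReal.ofReal_ne_top]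
        refine lintegral_congr fun y => ?_
        rw [lintegral_mul_const _ (by fun_prop), setLIntegral_Ioo_pow (tPlus_nonneg y), mul_assoc]
end

section
/- (Proposition 2.4, explicit form.) Let Ω ⊆ ℝ^d be a bounded open set with diameter D, let m be a Borel measure on ℝ^d, let k ∈ ℕ, and let λ ∈ ℂ with Re λ ≥ 0. Then for every measurable f : Ω × ℝ^d → ℂ one has ∫_{ℝ^d} ∫_Ω | ∫₀^{t₋(x,v)} s^k e^{−λs} f(x − s·v, v) ds | dx m(dv) ≤ (D^{k+1}/(k+1)) · ∫_{ℝ^d} ∫_Ω |v|^{−(k+1)} |f(x,v)| dx m(dv). (The inner integral is, up to the sign (−1)^k, the k-th derivative in λ of the resolvent of the free transport operator T₀ applied to f: (d^k/dλ^k) R(λ,T₀)f (x,v) = (−1)^k ∫₀^{t₋(x,v)} s^k e^{−λs} f(x−s·v,v) ds.) -/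
open MeasureTheory

/-- Before the backward exit time, the backward trajectory stays in `Ω`. -/
lemma sub_smul_mem_of_lt_tMinus {d : ℕ} {Ω : Set (EuclideanSpace ℝ (Fin d))}
    {x v : EuclideanSpace ℝ (Fin d)} {s : ℝ} (hs : 0 < s) (hst : s < tMinus Ω x v) :
    x - s • v ∈ Ω := by
  by_contra h
  exact notMem_of_lt_csInf hst ⟨0, fun _ ht => ht.1.le⟩ ⟨hs, h⟩

/-- At zero velocity, the exit time from a point of `Ω` takes the default value `0`. -/
lemma tMinus_zero_right {d : ℕ} {Ω : Set (EuclideanSpace ℝ (Fin d))}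
    {x : EuclideanSpace ℝ (Fin d)} (hx : x ∈ Ω) : tMinus Ω x 0 = 0 := by
  simp [tMinus, hx]

/-- A point of `Ω` leaves `Ω` backwards no later than `diam Ω / ‖v‖`. -/
lemma Ioo_tMinus_subset {d : ℕ} {Ω : Set (EuclideanSpace ℝ (Fin d))}
    (hΩb : Bornology.IsBounded Ω) {x v : EuclideanSpace ℝ (Fin d)} (hx : x ∈ Ω) (hv : v ≠ 0) :
    Set.Ioo 0 (tMinus Ω x v) ⊆ Set.Ioc 0 (Metric.diam Ω / ‖v‖) := by
  rintro s ⟨hs, hst⟩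
  refine ⟨hs, ?_⟩
  have h := Metric.dist_le_diam_of_mem hΩb hx (sub_smul_mem_of_lt_tMinus hs hst)
  rw [dist_eq_norm, sub_sub_cancel, norm_smul, Real.norm_of_nonneg hs.le] at h
  rwa [le_div_iff₀ (norm_pos_iff.mpr hv)]

lemma lintegral_Ioc_zero_pow (k : ℕ) {R : ℝ} (hR : 0 ≤ R) :
    ∫⁻ s in Set.Ioc 0 R, ENNReal.ofReal (s ^ k) = ENNReal.ofReal (R ^ (k + 1) / (k + 1 : ℝ)) := by
  rw [← ofReal_integral_eq_lintegral_ofReal, ← intervalIntegral.integral_of_le hR, integral_pow]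
  · simp
  · exact (continuous_pow k).integrableOn_Ioc
  · filter_upwards [ae_restrict_mem measurableSet_Ioc] with s hs
    exact pow_nonneg hs.1.le k

/-- Tonelli and translation invariance for weighted averages along parallel trajectories. -/
lemma lintegral_lintegral_mul_sub_smul {E : Type*} [NormedAddCommGroup E] [NormedSpace ℝ E]
    [MeasurableSpace E] [BorelSpace E] [SecondCountableTopology E]
    (μ : Measure E) [SFinite μ] [μ.IsAddRightInvariant] (ν : Measure ℝ) [SFinite ν]
    {w : ℝ → ENNReal} (hw : Measurable w) {g : E → ENNReal} (hg : Measurable g) (v : E) :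
    ∫⁻ x, ∫⁻ s, w s * g (x - s • v) ∂ν ∂μ = (∫⁻ s, w s ∂ν) * ∫⁻ x, g x ∂μ := by
  rw [lintegral_lintegral_swap (by unfold Function.uncurry; fun_prop),
    ← lintegral_mul_const _ hw]
  refine lintegral_congr fun s => ?_
  rw [lintegral_const_mul _ (by fun_prop), lintegral_sub_right_eq_self g]

/-- The weight `s ^ k * exp (-lam * s)` is dominated by `s ^ k` when `0 ≤ lam.re` and `0 ≤ s`. -/
lemma enorm_pow_mul_exp_mul_le (k : ℕ) {lam : ℂ} (hlam : 0 ≤ lam.re) {s : ℝ} (hs : 0 ≤ s)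
    (z : ℂ) :
    ‖(s : ℂ) ^ k * Complex.exp (-lam * (s : ℂ)) * z‖ₑ ≤ ENNReal.ofReal (s ^ k) * ‖z‖ₑ := by
  rw [← ofReal_norm, ← ofReal_norm, ← ENNReal.ofReal_mul (pow_nonneg hs k), norm_mul, norm_mul,
    norm_pow, Complex.norm_real, Real.norm_of_nonneg hs, Complex.norm_exp]
  have h : Real.exp (-lam * (s : ℂ)).re ≤ 1 := by
    rw [Real.exp_le_one_iff]
    simpa using mul_nonneg hlam hs
  gcongr
  exact mul_le_of_le_one_right (pow_nonneg hs k) h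

/-- **Proposition 2.4, explicit form.** For a bounded open `Ω ⊆ ℝ^d` with diameter `D`,
a Borel measure `m` on `ℝ^d`, `k ∈ ℕ`, `λ ∈ ℂ` with `Re λ ≥ 0`, and any measurable
`f : Ω × ℝ^d → ℂ`,
`∫∫ | ∫₀^{t₋(x,v)} s^k e^{−λs} f(x − s·v, v) ds | dx m(dv)
  ≤ (D^{k+1}/(k+1)) ∫∫ |v|^{−(k+1)} |f(x,v)| dx m(dv)`. -/
theorem resolvent_derivative_bound {d : ℕ}
    (Ω : Set (EuclideanSpace ℝ (Fin d))) (hΩo : IsOpen Ω) (hΩb : Bornology.IsBounded Ω)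
    (m : Measure (EuclideanSpace ℝ (Fin d)))
    (k : ℕ) (lam : ℂ) (hlam : 0 ≤ lam.re)
    (f : EuclideanSpace ℝ (Fin d) → EuclideanSpace ℝ (Fin d) → ℂ)
    (hf : Measurable (Function.uncurry f)) :
    (∫⁻ v, (∫⁻ x in Ω, ENNReal.ofReal
        ‖∫ s in Set.Ioo (0 : ℝ) (tMinus Ω x v),
            (s : ℂ) ^ k * Complex.exp (-lam * (s : ℂ)) * f (x - s • v) v‖) ∂m) ≤
      ENNReal.ofReal (Metric.diam Ω ^ (k + 1) / (k + 1 : ℝ)) *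
        ∫⁻ v, (∫⁻ x in Ω, ENNReal.ofReal ((‖v‖ ^ (k + 1))⁻¹ * ‖f x v‖)) ∂m := by
  rw [← lintegral_const_mul' _ _ ENNReal.ofReal_ne_top]
  refine lintegral_mono fun v => ?_
  rcases eq_or_ne v 0 with rfl | hv
  · refine le_of_eq_of_le ?_ zero_le
    refine (setLIntegral_congr_fun hΩo.measurableSet fun x hx => ?_).trans lintegral_zero
    simp [tMinus_zero_right hx]
  have hfv : Measurable fun x => f x v := hf.comp (measurable_id.prodMk measurable_const)
  let g : EuclideanSpace ℝ (Fin d) → ENNReal := Ω.indicator fun x => ‖f x v‖ₑ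
  have hg : Measurable g := hfv.enorm.indicator hΩo.measurableSet
  have hpointwise : ∀ x ∈ Ω, ENNReal.ofReal ‖∫ s in Set.Ioo (0 : ℝ) (tMinus Ω x v),
      (s : ℂ) ^ k * Complex.exp (-lam * (s : ℂ)) * f (x - s • v) v‖ ≤
      ∫⁻ s in Set.Ioc 0 (Metric.diam Ω / ‖v‖), ENNReal.ofReal (s ^ k) * g (x - s • v) := by
    intro x hx
    rw [ofReal_norm]
    refine (enorm_integral_le_lintegral_enorm _).trans
      ((setLIntegral_mono' measurableSet_Ioo fun s hs => ?_).trans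
        (lintegral_mono_set (Ioo_tMinus_subset hΩb hx hv)))
    simp only [g, Set.indicator_of_mem (sub_smul_mem_of_lt_tMinus hs.1 hs.2)]
    exact enorm_pow_mul_exp_mul_le k hlam hs.1.le _
  calc _ ≤ ∫⁻ x in Ω, ∫⁻ s in Set.Ioc 0 (Metric.diam Ω / ‖v‖),
          ENNReal.ofReal (s ^ k) * g (x - s • v) :=
        setLIntegral_mono' hΩo.measurableSet hpointwise
    _ ≤ ∫⁻ x, ∫⁻ s in Set.Ioc 0 (Metric.diam Ω / ‖v‖),
          ENNReal.ofReal (s ^ k) * g (x - s • v) := setLIntegral_le_lintegral _ _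
    _ = ENNReal.ofReal ((Metric.diam Ω / ‖v‖) ^ (k + 1) / (k + 1 : ℝ)) *
          ∫⁻ x in Ω, ‖f x v‖ₑ := by
        rw [lintegral_lintegral_mul_sub_smul _ _ (by fun_prop) hg,
          lintegral_Ioc_zero_pow k (div_nonneg Metric.diam_nonneg (norm_nonneg v)),
          lintegral_indicator hΩo.measurableSet]
    _ = _ := by
        have hD : 0 ≤ Metric.diam Ω ^ (k + 1) / (k + 1 : ℝ) := by
          have := Metric.diam_nonneg (s := Ω)
          positivity
        have hinv : 0 ≤ (‖v‖ ^ (k + 1))⁻¹ := by positivity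
        simp_rw [ENNReal.ofReal_mul hinv, ofReal_norm]
        rw [lintegral_const_mul' _ _ ENNReal.ofReal_ne_top, ← mul_assoc, ← ENNReal.ofReal_mul hD]
        congr 2
        rw [div_pow]
        ring
end

section
/- (Scalar identity underlying Lemma B.1.) Let d ≥ 2 and let σ, n ∈ ℝ^d be unit vectors (‖σ‖ = ‖n‖ = 1) whose last coordinates are denoted σ_d and n_d, with σ_d ≠ 0 and ⟨σ,n⟩ ≠ 0. Define p, u ∈ ℝ^{d−1} by pᵢ = σᵢ/σ_d and uᵢ = ( nᵢ − (n_d/σ_d)·σᵢ ) / ⟨σ,n⟩ for i = 1,…,d−1. Then (1 + ‖p‖²)(1 + ‖u‖²) − ⟨p,u⟩² = 1 / ( σ_d² · ⟨σ,n⟩² ). -/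
/-- **Scalar identity underlying Lemma B.1.** Let `d ≥ 2` and let `σ, n ∈ ℝ^d` be unit
vectors with last coordinates `σ_d ≠ 0` and with `⟨σ,n⟩ ≠ 0`. With
`pᵢ = σᵢ/σ_d` and `uᵢ = (nᵢ − (n_d/σ_d)·σᵢ)/⟨σ,n⟩` for `i = 1,…,d−1`, one has
`(1 + ‖p‖²)(1 + ‖u‖²) − ⟨p,u⟩² = 1/(σ_d²·⟨σ,n⟩²)`. -/
theorem scalar_identity_lemma_B1 (d : ℕ) (hd : 2 ≤ d)
    (σ n : Fin d → ℝ)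
    (hσunit : ∑ i, σ i ^ 2 = 1) (hnunit : ∑ i, n i ^ 2 = 1)
    (σd nd : ℝ)
    (hσd : σd = σ ⟨d - 1, by omega⟩) (hnd : nd = n ⟨d - 1, by omega⟩)
    (hσd0 : σd ≠ 0) (hσn0 : (∑ i, σ i * n i) ≠ 0)
    (p u : Fin (d - 1) → ℝ)
    (hp : ∀ i : Fin (d - 1), p i = σ (Fin.castLE (Nat.sub_le d 1) i) / σd)
    (hu : ∀ i : Fin (d - 1), u i =
      (n (Fin.castLE (Nat.sub_le d 1) i) - (nd / σd) * σ (Fin.castLE (Nat.sub_le d 1) i)) /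
        (∑ j, σ j * n j)) :
    (1 + ∑ i, p i ^ 2) * (1 + ∑ i, u i ^ 2) - (∑ i, p i * u i) ^ 2 =
      1 / (σd ^ 2 * (∑ j, σ j * n j) ^ 2) := by
  obtain ⟨k, rfl⟩ : ∃ k, d = k + 1 := ⟨d - 1, by omega⟩
  have sum_split (f : Fin (k + 1) → ℝ) :
      ∑ i, f i = ∑ i : Fin (k + 1 - 1), f (Fin.castLE (Nat.sub_le (k + 1) 1) i) +
        f ⟨k + 1 - 1, by omega⟩ := Fin.sum_univ_castSucc f
  have hσσ := sum_split fun i => σ i ^ 2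
  have hnn := sum_split fun i => n i ^ 2
  have hσn := sum_split fun i => σ i * n i
  simp only [← hσd, ← hnd, hσunit, hnunit] at hσσ hnn hσn
  generalize ∑ j, σ j * n j = c at *
  have hpp : ∑ i, p i ^ 2 = (1 - σd ^ 2) / σd ^ 2 := by
    rw [hσσ, add_sub_cancel_right, Finset.sum_div]
    exact Finset.sum_congr rfl fun i _ => by rw [hp, div_pow]
  have hpu : ∑ i, p i * u i =
      ((c - σd * nd) - nd / σd * (1 - σd ^ 2)) / (σd * c) := by
    rw [← eq_sub_of_add_eq hσn.symm, ← eq_sub_of_add_eq hσσ.symm,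
      Finset.mul_sum, ← Finset.sum_sub_distrib, Finset.sum_div]
    refine Finset.sum_congr rfl fun i _ => ?_
    rw [hp, hu]
    field_simp
  have huu : ∑ i, u i ^ 2 =
      ((1 - nd ^ 2) - 2 * (nd / σd) * (c - σd * nd) + (nd / σd) ^ 2 * (1 - σd ^ 2)) / c ^ 2 := by
    rw [← eq_sub_of_add_eq hσn.symm, ← eq_sub_of_add_eq hσσ.symm,
      ← eq_sub_of_add_eq hnn.symm, Finset.mul_sum, Finset.mul_sum,
      ← Finset.sum_sub_distrib, ← Finset.sum_add_distrib, Finset.sum_div]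
    refine Finset.sum_congr rfl fun i _ => ?_
    rw [hu]
    ring
  rw [hpp, hpu, huu]
  field_simp
  ring
end

section
/- (Gram determinant computation of Lemma B.1, explicit form.) Let d ≥ 2, let z ∈ ℝ^{d−1} with ‖z‖ < 1, set σ_d = √(1 − ‖z‖²) and σ = (z₁,…,z_{d−1}, σ_d) ∈ ℝ^d (a unit vector), let n ∈ ℝ^d be a unit vector with ⟨σ,n⟩ ≠ 0, and let τ > 0. For i = 1,…,d−1 define aᵢ = eᵢ − (zᵢ/σ_d)·e_d ∈ ℝ^d (where e₁,…,e_d is the standard basis) and wᵢ = −(τ/⟨σ,n⟩)·[ ⟨n,aᵢ⟩·σ + ⟨σ,n⟩·aᵢ ]. Then the Gram determinant satisfies det( (⟨wᵢ,wⱼ⟩)_{1≤i,j≤d−1} ) = ( τ^{d−1} / ( ⟨σ,n⟩ · σ_d ) )². -/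
/-- Determinant of a rank-two symmetric perturbation of the identity. -/
theorem Matrix.det_one_add_vecMulVec_add_vecMulVec {ι R : Type*} [Fintype ι] [DecidableEq ι]
    [CommRing R] (u v : ι → R) :
    (1 + Matrix.vecMulVec u u + Matrix.vecMulVec v v).det =
      (1 + ∑ i, u i ^ 2) * (1 + ∑ i, v i ^ 2) - (∑ i, u i * v i) ^ 2 := by
  have h : 1 + Matrix.vecMulVec u u + Matrix.vecMulVec v v =
      1 + (Matrix.of ![u, v]).transpose * Matrix.of ![u, v] := by
    ext i j
    simp [Matrix.mul_apply, Matrix.vecMulVec_apply, add_assoc]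
  have hc : ∑ i, v i * u i = ∑ i, u i * v i := Finset.sum_congr rfl fun i _ => mul_comm _ _
  rw [h, Matrix.det_one_add_mul_comm, Matrix.det_fin_two]
  simp only [Matrix.add_apply, Matrix.one_apply, Matrix.mul_apply, Matrix.transpose_apply,
    Matrix.of_apply, Matrix.cons_val_zero, Matrix.cons_val_one, hc, ← pow_two]
  simp [pow_two]

/-- **Gram determinant computation of Lemma B.1, explicit form.**
Here `d = m + 1 ≥ 2`. Given `z ∈ ℝ^{d−1}` with `‖z‖ < 1`, set `σ_d = √(1 − ‖z‖²)` and
`σ = (z, σ_d) ∈ ℝ^d` (a unit vector); let `n ∈ ℝ^d` be a unit vector with `⟨σ,n⟩ ≠ 0`,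
and `τ > 0`. With `aᵢ = eᵢ − (zᵢ/σ_d)·e_d` and
`wᵢ = −(τ/⟨σ,n⟩)·(⟨n,aᵢ⟩·σ + ⟨σ,n⟩·aᵢ)` for `i = 1,…,d−1`, the Gram determinant is
`det(⟨wᵢ,wⱼ⟩) = (τ^{d−1}/(⟨σ,n⟩·σ_d))²`. -/
theorem gram_det_lemma_B1 (m : ℕ) (hm : 1 ≤ m)
    (z : Fin m → ℝ) (hz : ∑ i, z i ^ 2 < 1)
    (σd : ℝ) (hσd : σd = Real.sqrt (1 - ∑ i, z i ^ 2))
    (σ : Fin (m + 1) → ℝ) (hσ : σ = Fin.snoc z σd)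
    (n : Fin (m + 1) → ℝ) (hn : ∑ j, n j ^ 2 = 1)
    (hσn : (∑ j, σ j * n j) ≠ 0)
    (τ : ℝ) (hτ : 0 < τ)
    (a : Fin m → Fin (m + 1) → ℝ)
    (ha : ∀ i, a i = (Pi.single (Fin.castSucc i) (1 : ℝ) : Fin (m + 1) → ℝ) -
      (z i / σd) • (Pi.single (Fin.last m) (1 : ℝ) : Fin (m + 1) → ℝ))
    (w : Fin m → Fin (m + 1) → ℝ)
    (hw : ∀ i, w i = (-(τ / (∑ j, σ j * n j))) •
      ((∑ j, n j * a i j) • σ + (∑ j, σ j * n j) • a i)) :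
    Matrix.det (Matrix.of fun i j : Fin m => ∑ l, w i l * w j l) =
      (τ ^ m / ((∑ j, σ j * n j) * σd)) ^ 2 := by
  have hpos : 0 < σd := hσd ▸ Real.sqrt_pos.mpr (by linarith)
  have hzz : ∑ i, z i ^ 2 = 1 - σd ^ 2 := by
    rw [hσd, Real.sq_sqrt (by linarith)]; ring
  set s := ∑ j, σ j * n j with hs
  set p := n (Fin.last m)
  have hzn : ∑ i, z i * n i.castSucc = s - σd * p := by
    rw [hs, hσ, Fin.sum_univ_castSucc]
    simp [p]
  have hnn : ∑ i : Fin m, n i.castSucc ^ 2 = 1 - p ^ 2 := by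
    rw [← hn, Fin.sum_univ_castSucc]; ring
  let b : Fin m → ℝ := fun i => n i.castSucc - z i / σd * p
  have hb : ∀ i, ∑ j, n j * a i j = b i := fun i => by
    simp [ha, mul_sub, Finset.sum_sub_distrib, Pi.single_apply, b, p, mul_comm]
  have hbz : ∑ i, b i * z i = s - p / σd := by
    have h : ∀ i, b i * z i = z i * n i.castSucc - p / σd * z i ^ 2 := fun i => by
      simp only [b]; ring
    simp only [h, Finset.sum_sub_distrib, ← Finset.mul_sum, hzn, hzz]
    field_simp
    ring
  have hbb : ∑ i, b i ^ 2 = 1 - 2 * s * p / σd + p ^ 2 / σd ^ 2 := by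
    have h : ∀ i, b i ^ 2 = n i.castSucc ^ 2 - 2 * p / σd * (z i * n i.castSucc) +
        p ^ 2 / σd ^ 2 * z i ^ 2 := fun i => by
      simp only [b]; ring
    simp only [h, Finset.sum_sub_distrib, Finset.sum_add_distrib, ← Finset.mul_sum, hzn, hzz, hnn]
    field_simp
    ring
  have hwc : ∀ i (l : Fin m), w i l.castSucc =
      -τ * (b i / s * z l + if l = i then 1 else 0) := fun i l => by
    rw [hw, hb, ha, hσ]
    simp [Pi.single_apply, Fin.castSucc_ne_last]
    split_ifs <;> field_simp <;> ring
  have hwl : ∀ i, w i (Fin.last m) = -τ * (b i / s * σd - z i / σd) := fun i => by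
    rw [hw, hb, ha, hσ]
    simp [(Fin.castSucc_ne_last _).symm]
    field_simp
    ring
  have hG : (Matrix.of fun i j : Fin m => ∑ l, w i l * w j l) =
      τ ^ 2 • (1 + Matrix.vecMulVec (fun i => b i / s) (fun i => b i / s) +
        Matrix.vecMulVec (fun i => z i / σd) (fun i => z i / σd)) := by
    ext i j
    have h : ∀ l : Fin m, w i l.castSucc * w j l.castSucc =
        τ ^ 2 * (b i / s * (b j / s)) * z l ^ 2 +
        (if l = j then τ ^ 2 * (b i / s) * z l else 0) +
        (if l = i then τ ^ 2 * (b j / s) * z l else 0) +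
        (if l = i then (if l = j then τ ^ 2 else 0) else 0) := fun l => by
      rw [hwc, hwc]; split_ifs <;> ring
    simp only [Matrix.of_apply, Fin.sum_univ_castSucc, h, hwl, Finset.sum_add_distrib,
      ← Finset.mul_sum, hzz, Finset.sum_ite_eq', Finset.mem_univ, if_true, Matrix.smul_apply,
      Matrix.add_apply, Matrix.one_apply, Matrix.vecMulVec_apply, smul_eq_mul]
    split_ifs <;> field_simp <;> ring
  have huv : ∑ i, b i / s * (z i / σd) = (s - p / σd) / (s * σd) := by
    simp only [div_mul_div_comm, ← Finset.sum_div, hbz]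
  rw [hG, Matrix.det_smul, Matrix.det_one_add_vecMulVec_add_vecMulVec, huv, Fintype.card_fin]
  simp only [div_pow, ← Finset.sum_div, hbb, hzz]
  field_simp
  ring
end
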